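/- arXiv:2006.03335 — 2 statements merged into one kernel-verified Lean document; each statement's English description precedes it below -/
import Mathlib

section
/- Let p ≥ 2. Then the only weak solution of the self-similar profile problem is the zero function: if ω ∈ H¹_K(ℝ₊) satisfies ∫₀^∞ (ω'(η)ζ'(η) − ω(η)ζ(η)/(2(p−1))) K(η) dη + |ω(0)|^{p−1}ω(0) ζ(0) = 0 for every ζ ∈ H¹_K(ℝ₊), then ω = 0 almost everywhere on (0,∞). -/
open MeasureTheory Real Set

noncomputable def Kw (η : ℝ) : ℝ := Real.exp (η ^ 2 / 4)

/-- An element of the weighted Sobolev space `H¹_K(ℝ₊)`, represented by its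
(absolutely) continuous representative on `[0,∞)` together with its
distributional derivative, both square integrable against the weight `K`. -/
structure H1K where
  toFun : ℝ → ℝ
  deriv' : ℝ → ℝ
  absCont : ∀ x : ℝ, 0 ≤ x → toFun x = toFun 0 + ∫ t in (0:ℝ)..x, deriv' t
  memL2 : Integrable (fun η => (toFun η) ^ 2 * Kw η) (volume.restrict (Ioi (0:ℝ)))
  derivMemL2 : Integrable (fun η => (deriv' η) ^ 2 * Kw η) (volume.restrict (Ioi (0:ℝ)))

/-- `ω` is a weak solution of the self-similar profile problem
`−ω'' − (η/2)ω' − ω/(2(p−1)) = 0` on `(0,∞)`, `−ω'(0) + |ω|^{p−1}ω(0) = 0`. -/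
def IsWeakProfile (p : ℝ) (ω : H1K) : Prop :=
  ∀ ζ : H1K,
    (∫ η in Ioi (0:ℝ),
        (ω.deriv' η * ζ.deriv' η - ω.toFun η * ζ.toFun η / (2 * (p - 1))) * Kw η)
      + |ω.toFun 0| ^ (p - 1) * ω.toFun 0 * ζ.toFun 0 = 0

lemma Kw_pos' (η : ℝ) : 0 < Kw η := Real.exp_pos _

lemma one_le_Kw (η : ℝ) : 1 ≤ Kw η := Real.one_le_exp (by positivity)

lemma hasDerivAt_Kw (η : ℝ) : HasDerivAt Kw (Kw η * (η / 2)) η := by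
  have h : HasDerivAt (fun x : ℝ => x ^ 2 / 4) (η / 2) η := by
    have := ((hasDerivAt_id η).pow 2).div_const 4
    exact this.congr_deriv (by simp; ring)
  exact h.exp

lemma contDiff_Kw : ContDiff ℝ 1 Kw := by
  unfold Kw
  fun_prop

/-- A weak profile automatically has an a.e. measurable derivative. -/
lemma aesm_deriv (p : ℝ) (ω : H1K) (hω : IsWeakProfile p ω) :
    AEStronglyMeasurable ω.deriv' (volume.restrict (Ioi (0:ℝ))) := by
  by_contra h
  set d := ω.deriv' with hd
  let S : Set ℝ := {x | 0 ≤ x ∧ AEStronglyMeasurable d (volume.restrict (Ioc 0 x))}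
  have h0 : (0:ℝ) ∈ S := ⟨le_rfl, by simp⟩
  have hbdd : BddAbove S := by
    by_contra hb
    apply h
    have hU : Ioi (0:ℝ) = ⋃ n : ℕ, Ioc (0:ℝ) n := by
      ext x
      simp only [mem_Ioi, mem_iUnion, mem_Ioc]
      constructor
      · intro hx
        obtain ⟨n, hn⟩ := exists_nat_ge x
        exact ⟨n, hx, hn⟩
      · rintro ⟨n, hx, _⟩
        exact hx
    rw [hU, aestronglyMeasurable_iUnion_iff]
    intro n
    rw [not_bddAbove_iff] at hb
    obtain ⟨y, hy, hny⟩ := hb n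
    exact hy.2.mono_measure (Measure.restrict_mono (Ioc_subset_Ioc_right hny.le) le_rfl)
  set x0 := sSup S with hx0
  have hx0n : 0 ≤ x0 := le_csSup hbdd h0
  have hm0 : AEStronglyMeasurable d (volume.restrict (Ioc 0 x0)) := by
    obtain ⟨u, _, hu, huS⟩ := exists_seq_tendsto_sSup ⟨0, h0⟩ hbdd
    rw [← Measure.restrict_congr_set (Ioo_ae_eq_Ioc (μ := volume) (a := (0:ℝ)) (b := x0))]
    have h1 : AEStronglyMeasurable d (volume.restrict (⋃ n, Ioc 0 (u n))) :=
      aestronglyMeasurable_iUnion_iff.2 fun n => (huS n).2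
    refine h1.mono_measure (Measure.restrict_mono ?_ le_rfl)
    intro x hx
    obtain ⟨n, hn⟩ := (hu.eventually (lt_mem_nhds hx.2)).exists
    exact mem_iUnion.2 ⟨n, hx.1, hn.le⟩
  have hnm : ∀ x, x0 < x → ¬ AEStronglyMeasurable d (volume.restrict (Ioc x0 x)) := by
    intro x hx hm
    have : x ∈ S := by
      refine ⟨hx0n.trans hx.le, ?_⟩
      rw [← Ioc_union_Ioc_eq_Ioc hx0n hx.le, aestronglyMeasurable_union_iff]
      exact ⟨hm0, hm⟩
    exact absurd (le_csSup hbdd this) (not_le.2 hx)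
  have hsq : (fun η => ((Ioi x0).indicator d η) ^ 2 * Kw η)
      = (Ioi x0).indicator (fun η => (d η) ^ 2 * Kw η) := by
    ext η
    by_cases hη : η ∈ Ioi x0 <;> simp [hη]
  let ζ : H1K :=
    { toFun := fun _ => 0
      deriv' := (Ioi x0).indicator d
      absCont := by
        intro x hx
        rcases le_or_gt x x0 with hxx | hxx
        · rw [intervalIntegral.integral_of_le hx]
          have : ∫ t in Ioc 0 x, (Ioi x0).indicator d t = ∫ t in Ioc 0 x, (0:ℝ) := by
            apply setIntegral_congr_fun measurableSet_Ioc
            intro t ht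
            exact indicator_of_notMem (by simpa using ht.2.trans hxx) _
          rw [this]; simp
        · rw [intervalIntegral.integral_undef]
          · simp
          · intro hi
            apply hnm x hxx
            rw [intervalIntegrable_iff_integrableOn_Ioc_of_le hx] at hi
            have h2 : AEStronglyMeasurable ((Ioi x0).indicator d) (volume.restrict (Ioc x0 x)) :=
              hi.aestronglyMeasurable.mono_measure
                (Measure.restrict_mono (Ioc_subset_Ioc_left hx0n) le_rfl)
            refine h2.congr ?_
            filter_upwards [ae_restrict_mem measurableSet_Ioc] with t ht
            exact indicator_of_mem (show t ∈ Ioi x0 from ht.1) _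
      memL2 := by simp
      derivMemL2 := by
        rw [hsq]
        exact ω.derivMemL2.indicator measurableSet_Ioi }
  have ht := hω ζ
  have h3 : (∫ η in Ioi (0:ℝ), (Ioi x0).indicator (fun η => (d η) ^ 2 * Kw η) η) = 0 := by
    refine Eq.trans ?_ ht
    simp only [ζ, mul_zero, zero_div, sub_zero, add_zero]
    refine integral_congr_ae (Filter.Eventually.of_forall fun η => ?_)
    simp only
    by_cases hη : η ∈ Ioi x0
    · rw [indicator_of_mem hη, indicator_of_mem hη, ← hd]; ring
    · simp [hη]
  rw [integral_eq_zero_iff_of_nonneg_ae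
    (Filter.Eventually.of_forall fun η => indicator_nonneg
      (fun η _ => mul_nonneg (sq_nonneg _) (Kw_pos' η).le) η)
    (ω.derivMemL2.indicator measurableSet_Ioi)] at h3
  apply hnm (x0 + 1) (by linarith)
  have h4 := ae_mono (Measure.restrict_mono (μ := volume) (ν := volume)
    (show Ioc x0 (x0+1) ⊆ Ioi (0:ℝ) from fun x hx => lt_of_le_of_lt hx0n hx.1) le_rfl) h3
  refine (aestronglyMeasurable_const (b := (0:ℝ))).congr ?_
  filter_upwards [h4, ae_restrict_mem measurableSet_Ioc] with t ht1 ht2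
  rw [indicator_of_mem (show t ∈ Ioi x0 from ht2.1)] at ht1
  have := (Kw_pos' t).ne'
  simp only [Pi.zero_apply, mul_eq_zero, this, or_false] at ht1
  exact (pow_eq_zero_iff (by norm_num)).1 ht1 |>.symm

lemma intervalIntegrable_deriv' (ω : H1K)
    (hm : AEStronglyMeasurable ω.deriv' (volume.restrict (Ioi (0:ℝ)))) (R : ℝ) (hR : 0 ≤ R) :
    IntervalIntegrable ω.deriv' volume 0 R := by
  rw [intervalIntegrable_iff_integrableOn_Ioc_of_le hR]
  have hs : Ioc 0 R ⊆ Ioi (0:ℝ) := fun x hx => hx.1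
  have h1 : IntegrableOn (fun η => 1 + (ω.deriv' η) ^ 2 * Kw η) (Ioc 0 R) :=
    Integrable.add (by simp) (IntegrableOn.mono_set ω.derivMemL2 hs)
  refine Integrable.mono' h1 (hm.mono_measure (Measure.restrict_mono hs le_rfl)) ?_
  filter_upwards with x
  rw [Real.norm_eq_abs]
  have := one_le_Kw x
  have h2 : (ω.deriv' x)^2 ≤ (ω.deriv' x)^2 * Kw x := le_mul_of_one_le_right (sq_nonneg _) this
  have h3 : |ω.deriv' x| ≤ 1 + (ω.deriv' x)^2 := by
    rw [← sq_abs]; nlinarith [sq_nonneg (|ω.deriv' x| - 1), abs_nonneg (ω.deriv' x)]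
  linarith

lemma ac_rep (ω : H1K)
    (hm : AEStronglyMeasurable ω.deriv' (volume.restrict (Ioi (0:ℝ)))) (R : ℝ) (hR : 0 ≤ R) :
    AbsolutelyContinuousOnInterval (fun x => ω.toFun 0 + ∫ t in (0:ℝ)..x, ω.deriv' t) 0 R ∧
    ∀ᵐ x, x ∈ uIcc 0 R →
      HasDerivAt (fun x => ω.toFun 0 + ∫ t in (0:ℝ)..x, ω.deriv' t) (ω.deriv' x) x := by
  have hi := intervalIntegrable_deriv' ω hm R hR
  constructor
  · have h1 : AbsolutelyContinuousOnInterval (fun _ : ℝ => ω.toFun 0) 0 R :=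
      ContDiffOn.absolutelyContinuousOnInterval contDiffOn_const
    exact h1.add (hi.absolutelyContinuousOnInterval_intervalIntegral (c := 0) (by simp))
  · filter_upwards [hi.ae_hasDerivAt_integral] with x hx hxR
    exact (hx hxR 0 (by simp)).const_add _

/-- The completed square on a finite interval. -/
lemma square_identity (ω : H1K)
    (hm : AEStronglyMeasurable ω.deriv' (volume.restrict (Ioi (0:ℝ)))) (R : ℝ) (hR : 0 ≤ R) :
    IntervalIntegrable (fun η => (ω.deriv' η + η / 2 * ω.toFun η) ^ 2 * Kw η) volume 0 R ∧
    ∫ η in (0:ℝ)..R, (ω.deriv' η + η / 2 * ω.toFun η) ^ 2 * Kw η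
      = (∫ η in (0:ℝ)..R, ((ω.deriv' η) ^ 2 * Kw η - (ω.toFun η) ^ 2 * Kw η / 2))
        + R * ((ω.toFun R) ^ 2 * Kw R) / 2 := by
  obtain ⟨hac, hder⟩ := ac_rep ω hm R hR
  set g : ℝ → ℝ := fun x => ω.toFun 0 + ∫ t in (0:ℝ)..x, ω.deriv' t with hg
  have hgω : ∀ x, 0 ≤ x → ω.toFun x = g x := ω.absCont
  let G : ℝ → ℝ := fun x => x * (g x * g x * Kw x)
  have hG : AbsolutelyContinuousOnInterval G 0 R :=
    (ContDiffOn.absolutelyContinuousOnInterval contDiffOn_id).fun_mul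
      ((hac.fun_mul hac).fun_mul
        (ContDiffOn.absolutelyContinuousOnInterval contDiff_Kw.contDiffOn))
  have hI := hG.integral_deriv_eq_sub
  have hs : Ioc 0 R ⊆ Ioi (0:ℝ) := fun x hx => hx.1
  have hDi : IntervalIntegrable
      (fun η => (ω.deriv' η) ^ 2 * Kw η - (ω.toFun η) ^ 2 * Kw η / 2) volume 0 R := by
    rw [intervalIntegrable_iff_integrableOn_Ioc_of_le hR]
    exact (IntegrableOn.mono_set ω.derivMemL2 hs).sub
      ((IntegrableOn.mono_set ω.memL2 hs).div_const 2)
  have hGi := (hG.intervalIntegrable_deriv).div_const 2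
  have hae : ∀ᵐ x, x ∈ uIoc 0 R → ((ω.deriv' x) ^ 2 * Kw x - (ω.toFun x) ^ 2 * Kw x / 2)
      + deriv G x / 2 = (ω.deriv' x + x / 2 * ω.toFun x) ^ 2 * Kw x := by
    filter_upwards [hder] with x hx hxR
    have hxR' := uIoc_subset_uIcc hxR
    have h1 := hx hxR'
    rw [uIoc_of_le hR] at hxR
    have h2 := (hasDerivAt_id x).mul ((h1.mul h1).mul (hasDerivAt_Kw x))
    have h3 : deriv G x = _ := h2.deriv
    rw [h3, hgω x hxR.1.le]
    simp
    ring
  constructor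
  · refine (hDi.add hGi).congr_ae ?_
    rw [Filter.EventuallyEq, ae_restrict_iff' measurableSet_uIoc]
    exact hae
  · rw [← intervalIntegral.integral_congr_ae hae, intervalIntegral.integral_add hDi hGi,
      intervalIntegral.integral_div, hI, hgω R hR]
    simp only [G]
    ring

theorem profile_trivial_of_two_le (p : ℝ) (hp : 2 ≤ p) (ω : H1K)
    (hω : IsWeakProfile p ω) :
    ∀ᵐ η ∂(volume.restrict (Ioi (0:ℝ))), ω.toFun η = 0 := by
  have hm := aesm_deriv p ω hω
  set B := |ω.toFun 0| ^ (p - 1) * ω.toFun 0 * ω.toFun 0 with hB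
  have hB0 : 0 ≤ B := by
    rw [hB, mul_assoc]
    exact mul_nonneg (Real.rpow_nonneg (abs_nonneg _) _) (mul_self_nonneg _)
  have hD : IntegrableOn (fun η => (ω.deriv' η) ^ 2 * Kw η - (ω.toFun η) ^ 2 * Kw η / 2)
      (Ioi (0:ℝ)) := Integrable.sub ω.derivMemL2 (ω.memL2.div_const 2)
  have hI : (∫ η in Ioi (0:ℝ), ((ω.deriv' η) ^ 2 * Kw η - (ω.toFun η) ^ 2 * Kw η / 2)) + B ≤ 0 := by
    refine le_trans ?_ (hω ω).le
    refine add_le_add ?_ le_rfl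
    have he : (fun η => (ω.deriv' η * ω.deriv' η - ω.toFun η * ω.toFun η / (2 * (p - 1))) * Kw η)
      = fun η => (ω.deriv' η) ^ 2 * Kw η - (ω.toFun η) ^ 2 * Kw η / (2 * (p - 1)) := by
      ext η; ring
    rw [he]
    refine integral_mono hD (Integrable.sub ω.derivMemL2 (ω.memL2.div_const _)) ?_
    intro η
    have hn : 0 ≤ (ω.toFun η) ^ 2 * Kw η := mul_nonneg (sq_nonneg _) (Kw_pos' η).le
    have : (ω.toFun η) ^ 2 * Kw η / (2 * (p - 1)) ≤ (ω.toFun η) ^ 2 * Kw η / 2 :=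
      div_le_div_of_nonneg_left hn (by norm_num) (by linarith)
    simp only
    linarith
  have hqn : ∀ η, 0 ≤ (ω.deriv' η + η / 2 * ω.toFun η) ^ 2 * Kw η :=
    fun η => mul_nonneg (sq_nonneg _) (Kw_pos' η).le
  have key : ∀ R, 0 ≤ R →
      (∫ η in (0:ℝ)..R, (ω.deriv' η + η / 2 * ω.toFun η) ^ 2 * Kw η) + B ≤ 0 := by
    intro R0 hR0
    by_contra hc
    push Not at hc
    set δ := (∫ η in (0:ℝ)..R0, (ω.deriv' η + η / 2 * ω.toFun η) ^ 2 * Kw η) + B with hδ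
    have hlim := intervalIntegral_tendsto_integral_Ioi (0:ℝ) hD Filter.tendsto_id
    have hev := hlim.eventually (gt_mem_nhds (show _ < -B + δ / 2 by linarith))
    obtain ⟨R1, hR1⟩ := Filter.eventually_atTop.1 hev
    set M := max (max R0 R1) 1 with hM
    have hbig : ∀ R, M < R → δ * R⁻¹ ≤ (ω.toFun R) ^ 2 * Kw R := by
      intro R hR
      have hRR0 : R0 ≤ R := ((le_max_left R0 R1).trans (le_max_left _ _)).trans hR.le
      have hRR1 : R1 ≤ R := ((le_max_right R0 R1).trans (le_max_left _ _)).trans hR.le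
      have hRp : 0 < R := lt_of_lt_of_le one_pos ((le_max_right _ _).trans hR.le)
      obtain ⟨hint, hid⟩ := square_identity ω hm R hRp.le
      have h1 := hR1 R hRR1
      have h2 : (∫ η in (0:ℝ)..R0, (ω.deriv' η + η / 2 * ω.toFun η) ^ 2 * Kw η)
          ≤ ∫ η in (0:ℝ)..R, (ω.deriv' η + η / 2 * ω.toFun η) ^ 2 * Kw η :=
        intervalIntegral.integral_mono_interval le_rfl hR0 hRR0
          (Filter.Eventually.of_forall hqn) hint
      simp only [id] at h1
      rw [← div_eq_mul_inv, div_le_iff₀ hRp]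
      linarith
    refine not_integrableOn_Ioi_inv (a := M) ?_
    have hMp : 0 < M := lt_of_lt_of_le one_pos (le_max_right _ _)
    have hI2 : IntegrableOn (fun η => δ⁻¹ * ((ω.toFun η) ^ 2 * Kw η)) (Ioi M) :=
      (IntegrableOn.mono_set ω.memL2 (Ioi_subset_Ioi hMp.le)).const_mul _
    refine Integrable.mono' hI2 measurable_inv.aestronglyMeasurable ?_
    filter_upwards [ae_restrict_mem measurableSet_Ioi] with x hx
    have hx' : 0 < x := hMp.trans hx
    rw [Real.norm_of_nonneg (by positivity)]
    rw [inv_mul_eq_div, le_div_iff₀ hc, mul_comm]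
    exact hbig x hx
  have hB1 : B = 0 := by
    have := key 0 le_rfl
    simp at this
    linarith
  have hω0 : ω.toFun 0 = 0 := by
    by_contra hne
    have h1 : 0 < |ω.toFun 0| ^ (p - 1) := Real.rpow_pos_of_pos (abs_pos.2 hne) _
    have := mul_pos h1 (mul_self_pos.2 hne)
    rw [hB, mul_assoc] at hB1
    linarith
  have hall : ∀ R, 0 < R → ω.toFun R = 0 := by
    intro R hR
    obtain ⟨hint, -⟩ := square_identity ω hm R hR.le
    have hz : (∫ η in (0:ℝ)..R, (ω.deriv' η + η / 2 * ω.toFun η) ^ 2 * Kw η) = 0 :=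
      le_antisymm (by linarith [key R hR.le])
        (intervalIntegral.integral_nonneg hR.le fun η _ => hqn η)
    rw [intervalIntegral.integral_eq_zero_iff_of_le_of_nonneg_ae hR.le
      (Filter.Eventually.of_forall hqn) hint, Filter.EventuallyEq,
      ae_restrict_iff' measurableSet_Ioc] at hz
    obtain ⟨hac, hder⟩ := ac_rep ω hm R hR.le
    set g : ℝ → ℝ := fun x => ω.toFun 0 + ∫ t in (0:ℝ)..x, ω.deriv' t with hg
    have hgω : ∀ x, 0 ≤ x → ω.toFun x = g x := ω.absCont
    have hW : AbsolutelyContinuousOnInterval (fun x => g x * Kw x) 0 R :=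
      hac.fun_mul (ContDiffOn.absolutelyContinuousOnInterval contDiff_Kw.contDiffOn)
    have hWd : ∀ᵐ x, x ∈ uIcc 0 R → HasDerivAt (fun x => g x * Kw x) 0 x := by
      have hne : ∀ᵐ x : ℝ, x ≠ 0 := by simp [ae_iff, measure_singleton]
      filter_upwards [hz, hder, hne] with x h1 h2 h3 hx
      have h4 := (h2 hx).mul (hasDerivAt_Kw x)
      rw [uIcc_of_le hR.le] at hx
      have h5 := h1 ⟨lt_of_le_of_ne hx.1 h3.symm, hx.2⟩
      simp only [Pi.zero_apply, mul_eq_zero, (Kw_pos' x).ne', or_false] at h5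
      have h6 := (pow_eq_zero_iff (by norm_num)).1 h5
      rw [hgω x hx.1] at h6
      exact h4.congr_deriv (by linear_combination (Kw x) * h6)
    obtain ⟨C, hC⟩ := hW.const_of_ae_hasDerivAt_zero hWd
    have e1 := hC 0 (by simp)
    have e2 := hC R (by simp)
    simp only [← hgω 0 le_rfl, ← hgω R hR.le, hω0, zero_mul] at e1 e2
    rw [← e1] at e2
    exact (mul_eq_zero.1 e2).resolve_right (Kw_pos' R).ne'
  filter_upwards [ae_restrict_mem measurableSet_Ioi] with x hx using hall x hx
end

section
/- Let 3/2 < p < 2. The linear ordinary differential equation ω'' + (η/2)ω' + ω/(2(p−1)) = 0 on (0,∞) admits two linearly independent solutions ω₁ and ω₂ for which there exist constants c₁ > 0 and c₂ > 0 such that lim_{η→∞} ω₁(η) e^{η²/4} η^{1 − 1/(p−1)} = c₁ and lim_{η→∞} ω₂(η) η^{1/(p−1)} = c₂. Consequently, every solution ω of this equation satisfying lim_{η→∞} η^{1/(p−1)} ω(η) = 0 is a scalar multiple of ω₁. -/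
open Real Set Filter Topology

/-- `ω` (with first derivative `d` and second derivative `dd`) is a twice
continuously differentiable solution on `(0,∞)` of the ODE
`ω'' + (η/2)ω' + ω/(2(p−1)) = 0`. -/
def IsODESol (p : ℝ) (ω d dd : ℝ → ℝ) : Prop :=
  (∀ η : ℝ, 0 < η → HasDerivAt ω (d η) η) ∧
  (∀ η : ℝ, 0 < η → HasDerivAt d (dd η) η) ∧
  ContinuousOn dd (Ioi 0) ∧
  ∀ η : ℝ, 0 < η → dd η + (η / 2) * d η + ω η / (2 * (p - 1)) = 0

open MeasureTheory in
/-- The moment integrals. -/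
noncomputable def JJ (a η : ℝ) : ℝ := ∫ s in Ioi (0:ℝ), s ^ a * Real.exp (-(η * s) - s ^ 2)

open MeasureTheory

lemma JJ_meas (a η : ℝ) : AEStronglyMeasurable (fun s : ℝ => s ^ a * Real.exp (-(η * s) - s ^ 2))
    (volume.restrict (Ioi 0)) := by
  apply Measurable.aestronglyMeasurable
  fun_prop

lemma JJ_int {a η : ℝ} (ha : -1 < a) (hη : 0 ≤ η) :
    IntegrableOn (fun s : ℝ => s ^ a * Real.exp (-(η * s) - s ^ 2)) (Ioi 0) := by
  refine Integrable.mono' (integrableOn_rpow_mul_exp_neg_mul_sq one_pos ha) (JJ_meas a η) ?_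
  filter_upwards [ae_restrict_mem measurableSet_Ioi] with s hs
  have hs : 0 < s := hs
  rw [Real.norm_of_nonneg (by positivity)]
  gcongr
  nlinarith [mul_nonneg hη hs.le]

lemma JJ_pos {a η : ℝ} (ha : -1 < a) (hη : 0 ≤ η) : 0 < JJ a η := by
  unfold JJ
  rw [setIntegral_pos_iff_support_of_nonneg_ae _ (JJ_int ha hη)]
  · have : (Function.support fun s : ℝ => s ^ a * Real.exp (-(η * s) - s ^ 2)) ∩ Ioi 0 = Ioi 0 := by
      apply inter_eq_right.2
      intro s hs
      have hs : 0 < s := hs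
      simp only [Function.mem_support]
      positivity
    rw [this]; simp
  · filter_upwards [ae_restrict_mem measurableSet_Ioi] with s hs
    have hs : 0 < s := hs
    simp only [Pi.zero_apply]
    positivity

lemma JJ_deriv {a η : ℝ} (ha : -1 < a) (hη : 0 < η) :
    HasDerivAt (JJ a) (-JJ (a + 1) η) η := by
  have := (hasDerivAt_integral_of_dominated_loc_of_deriv_le (μ := volume.restrict (Ioi (0:ℝ)))
    (F := fun η s : ℝ => s ^ a * Real.exp (-(η * s) - s ^ 2))
    (F' := fun η s : ℝ => -(s ^ (a + 1) * Real.exp (-(η * s) - s ^ 2)))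
    (bound := fun s => s ^ (a + 1) * Real.exp (-(0 * s) - s ^ 2)) (x₀ := η)
    (Ioi_mem_nhds hη) (Eventually.of_forall fun x => JJ_meas a x) (JJ_int ha hη.le)
    (JJ_meas (a + 1) η).neg ?_ (JJ_int (by linarith) le_rfl) ?_).2
  · rw [integral_neg] at this
    exact this
  · filter_upwards [ae_restrict_mem measurableSet_Ioi] with s hs x hx
    have hs : 0 < s := hs
    have hx : 0 < x := hx
    rw [norm_neg, Real.norm_of_nonneg (by positivity)]
    gcongr
  · filter_upwards [ae_restrict_mem measurableSet_Ioi] with s hs x hx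
    have hs : 0 < s := hs
    have h : HasDerivAt (fun x : ℝ => -(x * s) - s ^ 2) (-(1 * s)) x :=
      (((hasDerivAt_id x).mul_const s).neg).sub_const _
    convert! (h.exp).const_mul (s ^ a) using 1
    rw [rpow_add_one hs.ne']; ring

lemma tend_pow_exp (s : ℝ) {b : ℝ} (hb : 0 < b) :
    Tendsto (fun x : ℝ => x ^ s * rexp (-b * x ^ 2)) atTop (𝓝 0) :=
  (rpow_mul_exp_neg_mul_sq_isLittleO_exp_neg hb s).tendsto_zero_of_tendsto
      (tendsto_exp_atBot.comp <| tendsto_id.const_mul_atTop_of_neg (neg_lt_zero.mpr one_half_pos))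

lemma JJ_ibp {a η : ℝ} (ha : -1 < a) (hη : 0 ≤ η) :
    (a + 1) * JJ a η = η * JJ (a + 1) η + 2 * JJ (a + 2) η := by
  have h0 := JJ_int ha hη
  have h1 := JJ_int (a := a + 1) (by linarith) hη
  have h2 := JJ_int (a := a + 2) (by linarith) hη
  have key := integral_Ioi_of_hasDerivAt_of_tendsto (a := (0:ℝ)) (m := 0)
    (f := fun s : ℝ => s ^ (a + 1) * Real.exp (-(η * s) - s ^ 2))
    (f' := fun s : ℝ => (a + 1) * (s ^ a * Real.exp (-(η * s) - s ^ 2))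
      - η * (s ^ (a + 1) * Real.exp (-(η * s) - s ^ 2))
      - 2 * (s ^ (a + 2) * Real.exp (-(η * s) - s ^ 2))) ?_ ?_ ?_ ?_
  · have h01 : IntegrableOn (fun s : ℝ => (a + 1) * (s ^ a * Real.exp (-(η * s) - s ^ 2))
      - η * (s ^ (a + 1) * Real.exp (-(η * s) - s ^ 2))) (Ioi 0) :=
      (h0.const_mul _).sub (h1.const_mul _)
    rw [integral_sub h01 (h2.const_mul _),
      integral_sub (h0.const_mul _) (h1.const_mul _), integral_const_mul, integral_const_mul,
      integral_const_mul, zero_rpow (by linarith)] at key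
    unfold JJ
    linarith
  · apply ContinuousAt.continuousWithinAt
    apply ContinuousAt.mul
    · exact continuousAt_rpow_const _ _ (Or.inr (by linarith))
    · fun_prop
  · intro s hs
    have hs : 0 < s := hs
    have hA : HasDerivAt (fun x : ℝ => -(η * x) - x ^ 2) (-(η * 1) - (2 : ℕ) * s ^ (2 - 1)) s :=
      (((hasDerivAt_id s).const_mul η).neg).sub (hasDerivAt_pow 2 s)
    convert! (hasDerivAt_rpow_const (p := a + 1) (Or.inl hs.ne')).mul hA.exp using 1
    have e2 : s ^ (a + 2) = s ^ a * s * s := by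
      rw [show a + 2 = a + 1 + 1 by ring, rpow_add_one hs.ne', rpow_add_one hs.ne']
    rw [e2, rpow_add_one hs.ne', add_sub_cancel_right]
    push_cast
    ring
  · exact ((h0.const_mul _).sub (h1.const_mul _)).sub (h2.const_mul _)
  · refine squeeze_zero' ?_ ?_ (tend_pow_exp (a + 1) one_pos)
    · filter_upwards [eventually_gt_atTop 0] with s hs
      positivity
    · filter_upwards [eventually_gt_atTop 0] with s hs
      gcongr
      nlinarith [mul_nonneg hη hs.le]

lemma GG_int {a η : ℝ} (ha : -1 < a) (hη : 0 < η) :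
    IntegrableOn (fun s : ℝ => s ^ a * Real.exp (-(η * s))) (Ioi 0) := by
  have := integrableOn_rpow_mul_exp_neg_mul_rpow (p := 1) ha one_pos hη
  simpa using this

lemma JJ_tendsto {a : ℝ} (ha : -1 < a) :
    Tendsto (fun η : ℝ => JJ a η * η ^ (a + 1)) atTop (𝓝 (Real.Gamma (a + 1))) := by
  have hval : ∀ b η : ℝ, -1 < b → 0 < η → ∫ s in Ioi (0:ℝ), s ^ b * Real.exp (-(η * s))
      = (1 / η) ^ (b + 1) * Real.Gamma (b + 1) := by
    intro b η hb hη
    have := Real.integral_rpow_mul_exp_neg_mul_Ioi (a := b + 1) (r := η) (by linarith) hη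
    simpa using this
  have hmul : ∀ η : ℝ, 0 < η → (1 / η) ^ (a + 1) * η ^ (a + 1) = 1 := by
    intro η hη
    rw [← mul_rpow (by positivity) hη.le, one_div_mul_cancel hη.ne', one_rpow]
  have hlow : Tendsto (fun η : ℝ => Real.Gamma (a + 1) - (1 / η) ^ 2 * Real.Gamma (a + 3)) atTop
      (𝓝 (Real.Gamma (a + 1))) := by
    have h1 : Tendsto (fun η : ℝ => 1 / η) atTop (𝓝 0) := by
      simpa using tendsto_inv_atTop_zero (𝕜 := ℝ)
    simpa using ((h1.pow 2).mul_const (Real.Gamma (a + 3))).const_sub (Real.Gamma (a + 1))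
  refine tendsto_of_tendsto_of_tendsto_of_le_of_le' hlow tendsto_const_nhds ?_ ?_
  · filter_upwards [eventually_gt_atTop 0] with η hη
    have : (1 / η) ^ (a + 1) * Real.Gamma (a + 1) - (1 / η) ^ (a + 3) * Real.Gamma (a + 3)
        ≤ JJ a η := by
      rw [← hval a η ha hη, show a + 3 = (a + 2) + 1 by ring, ← hval (a + 2) η (by linarith) hη,
        ← integral_sub (GG_int ha hη) (GG_int (by linarith) hη)]
      refine setIntegral_mono_on ((GG_int ha hη).sub (GG_int (by linarith) hη)) (JJ_int ha hη.le)
        measurableSet_Ioi ?_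
      intro s hs
      have hs : 0 < s := hs
      have e2 : s ^ (a + 2) = s ^ a * s ^ 2 := by
        rw [rpow_add hs, rpow_two]
      have := Real.add_one_le_exp (-s ^ 2)
      rw [e2, sub_eq_add_neg (-(η * s)), Real.exp_add]
      have hp : 0 < s ^ a * Real.exp (-(η * s)) := by positivity
      nlinarith [mul_le_mul_of_nonneg_left this hp.le]
    have h3 := mul_le_mul_of_nonneg_right this (rpow_nonneg hη.le (a + 1))
    have e3 : (1 / η) ^ (a + 3) = (1 / η) ^ (a + 1) * (1 / η) ^ 2 := by
      rw [show a + 3 = (a + 1) + 2 by ring, rpow_add (by positivity), rpow_two]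
    refine le_trans (le_of_eq ?_) h3
    rw [e3]
    linear_combination (-Real.Gamma (a + 1) + (1 / η) ^ 2 * Real.Gamma (a + 3)) * hmul η hη
  · filter_upwards [eventually_gt_atTop 0] with η hη
    have : JJ a η ≤ (1 / η) ^ (a + 1) * Real.Gamma (a + 1) := by
      rw [← hval a η ha hη]
      refine setIntegral_mono_on (JJ_int ha hη.le) (GG_int ha hη) measurableSet_Ioi ?_
      intro s hs
      have hs : 0 < s := hs
      gcongr
      nlinarith
    have h3 := mul_le_mul_of_nonneg_right this (rpow_nonneg hη.le (a + 1))
    refine le_trans h3 (le_of_eq ?_)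
    linear_combination Real.Gamma (a + 1) * hmul η hη

lemma lhop_aux {F G F' G' : ℝ → ℝ} {M ε : ℝ} (hε : 0 < ε)
    (hF : ∀ᶠ x in atTop, HasDerivAt F (F' x) x) (hG : ∀ᶠ x in atTop, HasDerivAt G (G' x) x)
    (hle : ∀ᶠ x in atTop, F' x ≤ M * G' x) (hGt : Tendsto G atTop atTop) :
    ∀ᶠ x in atTop, F x / G x < M + ε := by
  obtain ⟨A, hA⟩ := eventually_atTop.1 ((hF.and hG).and hle)
  have hd : ∀ x ∈ Ici A, HasDerivAt (fun x => F x - M * G x) (F' x - M * G' x) x :=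
    fun x hx => (hA x hx).1.1.sub ((hA x hx).1.2.const_mul M)
  have anti : AntitoneOn (fun x => F x - M * G x) (Ici A) := by
    apply antitoneOn_of_deriv_nonpos (convex_Ici A)
    · exact fun x hx => (hd x hx).continuousAt.continuousWithinAt
    · exact fun x hx => (hd x (interior_subset hx)).differentiableAt.differentiableWithinAt
    · intro x hx
      rw [(hd x (interior_subset hx)).deriv]
      linarith [(hA x (interior_subset hx)).2]
  filter_upwards [eventually_ge_atTop A, hGt.eventually_gt_atTop 0,
    hGt.eventually_gt_atTop ((F A - M * G A) / ε)] with x hx h0 h1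
  have := anti (Set.mem_Ici.2 le_rfl) hx hx
  simp only at this
  rw [div_lt_iff₀ h0]
  rw [div_lt_iff₀ hε] at h1
  linarith

lemma lhop {F G F' G' : ℝ → ℝ} {L : ℝ}
    (hF : ∀ᶠ x in atTop, HasDerivAt F (F' x) x) (hG : ∀ᶠ x in atTop, HasDerivAt G (G' x) x)
    (hpos : ∀ᶠ x in atTop, 0 < G' x) (hGt : Tendsto G atTop atTop)
    (hL : Tendsto (fun x => F' x / G' x) atTop (𝓝 L)) :
    Tendsto (fun x => F x / G x) atTop (𝓝 L) := by
  refine tendsto_order.2 ⟨fun c hc => ?_, fun c hc => ?_⟩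
  · have h := lhop_aux (F := fun x => -F x) (F' := fun x => -F' x) (M := -((L + c) / 2))
      (ε := (L - c) / 2) (by linarith) (hF.mono fun x hx => hx.neg) hG ?_ hGt
    · filter_upwards [h] with x hx
      rw [neg_div] at hx
      linarith
    · filter_upwards [hpos, hL.eventually_const_lt (show (L + c) / 2 < L by linarith)] with x h0 h1
      rw [lt_div_iff₀ h0] at h1
      linarith
  · have h := lhop_aux (M := ((L + c) / 2))
      (ε := (c - L) / 2) (by linarith) hF hG ?_ hGt
    · filter_upwards [h] with x hx
      linarith
    · filter_upwards [hpos, hL.eventually_lt_const (show L < (L + c) / 2 by linarith)] with x h0 h1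
      rw [div_lt_iff₀ h0] at h1
      linarith

lemma isODESol_mk {p : ℝ} {ω d dd : ℝ → ℝ} (h1 : ∀ η : ℝ, 0 < η → HasDerivAt ω (d η) η)
    (h2 : ∀ η : ℝ, 0 < η → HasDerivAt d (dd η) η)
    (h3 : ∀ η : ℝ, 0 < η → dd η + (η / 2) * d η + ω η / (2 * (p - 1)) = 0) :
    IsODESol p ω d dd := by
  refine ⟨h1, h2, ?_, h3⟩
  have hω : ContinuousOn ω (Ioi 0) := fun x hx => (h1 x hx).continuousAt.continuousWithinAt
  have hd : ContinuousOn d (Ioi 0) := fun x hx => (h2 x hx).continuousAt.continuousWithinAt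
  have : ContinuousOn (fun η => -((η / 2) * d η) - ω η / (2 * (p - 1))) (Ioi 0) := by fun_prop
  refine this.congr fun x hx => ?_
  linarith [h3 x hx]

lemma hasDerivAt_gauss (η : ℝ) :
    HasDerivAt (fun x : ℝ => Real.exp (-(x ^ 2 / 4))) (-(η / 2) * Real.exp (-(η ^ 2 / 4))) η := by
  have h : HasDerivAt (fun x : ℝ => -(x ^ 2 / 4)) (-(η / 2)) η := by
    convert! ((hasDerivAt_pow 2 η).div_const 4).neg using 1
    push_cast; ring
  convert! h.exp using 1
  ring

lemma exists_first (p : ℝ) (hp1 : 3 / 2 < p) (hp2 : p < 2) :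
    ∃ ω₁ d₁ dd₁ : ℝ → ℝ, IsODESol p ω₁ d₁ dd₁ ∧ (∀ η : ℝ, 0 < η → 0 < ω₁ η) ∧
      ∃ c₁ : ℝ, 0 < c₁ ∧
        Tendsto (fun η : ℝ => ω₁ η * Real.exp (η ^ 2 / 4) * η ^ (1 - 1 / (p - 1)))
          atTop (𝓝 c₁) := by
  have hp : 0 < p - 1 := by linarith
  obtain ⟨μ, hμ⟩ : ∃ μ : ℝ, μ = 1 / (p - 1) - 1 := ⟨_, rfl⟩
  have hμ1 : μ < 1 := by
    have : 1 / (p - 1) < 2 := by rw [div_lt_iff₀ hp]; linarith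
    linarith
  have hm : ∀ x : ℝ, x / (2 * (p - 1)) = (μ + 1) / 2 * x := by
    intro x; rw [hμ]; field_simp; ring
  have he : 1 - 1 / (p - 1) = -μ := by rw [hμ]; ring
  rw [he]
  have hJ : ∀ η : ℝ, 0 < η → HasDerivAt (JJ (-μ)) (-JJ (1 - μ) η) η := by
    intro η hη
    have := JJ_deriv (a := -μ) (by linarith) hη
    rwa [show -μ + 1 = 1 - μ by ring] at this
  have hibp : ∀ η : ℝ, 0 < η →
      (1 - μ) * JJ (-μ) η = η * JJ (1 - μ) η + 2 * JJ (2 - μ) η := by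
    intro η hη
    have := JJ_ibp (a := -μ) (by linarith) hη.le
    rwa [show -μ + 1 = 1 - μ by ring, show -μ + 2 = 2 - μ by ring] at this
  have hv : ∀ η : ℝ, 0 < η →
      HasDerivAt (fun x => JJ (1 - μ) x + x / 2 * JJ (-μ) x) (μ / 2 * JJ (-μ) η) η := by
    intro η hη
    have h1 := JJ_deriv (a := 1 - μ) (by linarith) hη
    rw [show 1 - μ + 1 = 2 - μ by ring] at h1
    convert! h1.add (((hasDerivAt_id η).div_const 2).mul (hJ η hη)) using 1
    simp only [id]
    linarith [hibp η hη]
  obtain ⟨v, hvdef⟩ : ∃ v : ℝ → ℝ, v = fun x => JJ (1 - μ) x + x / 2 * JJ (-μ) x := ⟨_, rfl⟩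
  rw [← hvdef] at hv
  have hvpos : ∀ η : ℝ, 0 < η → 0 < v η := by
    intro η hη
    have h1 := JJ_pos (a := 1 - μ) (by linarith) hη.le
    have h2 := JJ_pos (a := -μ) (by linarith) hη.le
    rw [hvdef]
    positivity
  refine ⟨fun η => Real.exp (-(η ^ 2 / 4)) * v η,
    fun η => Real.exp (-(η ^ 2 / 4)) * (μ / 2 * JJ (-μ) η - η / 2 * v η),
    fun η => -(η / 2) * (Real.exp (-(η ^ 2 / 4)) * (μ / 2 * JJ (-μ) η - η / 2 * v η))
      - (μ + 1) / 2 * (Real.exp (-(η ^ 2 / 4)) * v η), ?_, ?_, Real.Gamma (1 - μ) / 2, ?_, ?_⟩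
  · refine isODESol_mk ?_ ?_ ?_
    · intro η hη
      convert! (hasDerivAt_gauss η).mul (hv η hη) using 1
      ring
    · intro η hη
      convert! (hasDerivAt_gauss η).mul (((hJ η hη).const_mul (μ / 2)).sub
        (((hasDerivAt_id η).div_const 2).mul (hv η hη))) using 1
      simp only [id, hvdef, Pi.sub_apply, Pi.mul_apply]
      ring
    · intro η hη
      rw [hm]
      ring
  · intro η hη
    have := hvpos η hη
    positivity
  · have := Real.Gamma_pos_of_pos (s := 1 - μ) (by linarith)
    positivity
  · have t1 : Tendsto (fun η : ℝ => JJ (1 - μ) η * η ^ (2 - μ)) atTop (𝓝 (Real.Gamma (2 - μ))) := by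
      have := JJ_tendsto (a := 1 - μ) (by linarith)
      rwa [show 1 - μ + 1 = 2 - μ by ring] at this
    have t0 : Tendsto (fun η : ℝ => JJ (-μ) η * η ^ (1 - μ)) atTop (𝓝 (Real.Gamma (1 - μ))) := by
      have := JJ_tendsto (a := -μ) (by linarith)
      rwa [show -μ + 1 = 1 - μ by ring] at this
    have ti : Tendsto (fun η : ℝ => (η ^ 2)⁻¹) atTop (𝓝 0) :=
      (tendsto_pow_atTop two_ne_zero).inv_tendsto_atTop
    have := (t1.mul ti).add (t0.div_const 2)
    rw [mul_zero, zero_add] at this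
    refine this.congr' ?_
    filter_upwards [eventually_gt_atTop 0] with η hη
    have e1 : η ^ (2 - μ) = η ^ (-μ) * η ^ 2 := by
      rw [show 2 - μ = -μ + 2 by ring, rpow_add hη, rpow_two]
    have e2 : η ^ (1 - μ) = η ^ (-μ) * η := by
      rw [show 1 - μ = -μ + 1 by ring, rpow_add_one hη.ne']
    rw [e1, e2, Real.exp_neg, hvdef]
    field_simp

lemma main_aux (m : ℝ) {ω : ℝ → ℝ} {F : ℝ → ℝ} {c : ℝ} (hc : 0 < c)
    (hpos : ∀ η : ℝ, 0 < η → 0 < ω η)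
    (ht : Tendsto (fun η : ℝ => ω η * Real.exp (η ^ 2 / 4) * η ^ (1 - m)) atTop (𝓝 c))
    (hF : ∀ η : ℝ, 0 < η → HasDerivAt F (Real.exp (-(η ^ 2 / 4)) / ω η ^ 2) η) :
    Tendsto (fun η : ℝ => ω η * F η * η ^ m) atTop (𝓝 (2 / c)) := by
  have hG : ∀ η : ℝ, 0 < η → HasDerivAt (fun x : ℝ => Real.exp (x ^ 2 / 4) * x ^ (1 - 2 * m))
      (Real.exp (η ^ 2 / 4) * η ^ (-(2 * m)) * (η ^ 2 / 2 + (1 - 2 * m))) η := by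
    intro η hη
    have h : HasDerivAt (fun x : ℝ => x ^ 2 / 4) (η / 2) η := by
      convert! ((hasDerivAt_pow 2 η).div_const 4) using 1
      push_cast; ring
    convert! h.exp.mul (hasDerivAt_rpow_const (p := 1 - 2 * m) (Or.inl hη.ne')) using 1
    rw [show 1 - 2 * m - 1 = -(2 * m) by ring, show 1 - 2 * m = -(2 * m) + 1 by ring,
      rpow_add_one hη.ne']
    ring
  have hGt : Tendsto (fun x : ℝ => Real.exp (x ^ 2 / 4) * x ^ (1 - 2 * m)) atTop atTop := by
    have h0 := tend_pow_exp (2 * m - 1) (b := 1 / 4) (by norm_num)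
    have h1 : Tendsto (fun x : ℝ => x ^ (2 * m - 1) * rexp (-(1 / 4) * x ^ 2)) atTop (𝓝[>] 0) := by
      refine tendsto_nhdsWithin_iff.2 ⟨h0, ?_⟩
      filter_upwards [eventually_gt_atTop 0] with x hx
      exact mem_Ioi.2 (by positivity)
    refine h1.inv_tendsto_nhdsGT_zero.congr' ?_
    filter_upwards [eventually_gt_atTop 0] with x hx
    simp only [Pi.inv_apply]
    rw [mul_inv, ← rpow_neg hx.le, ← Real.exp_neg, mul_comm]
    congr 2 <;> ring
  have t2 : Tendsto (fun η : ℝ => η ^ 2) atTop atTop := tendsto_pow_atTop two_ne_zero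
  have hr : Tendsto (fun η : ℝ => (1 / 2 + (1 - 2 * m) * (η ^ 2)⁻¹)⁻¹) atTop (𝓝 2) := by
    have := ((t2.inv_tendsto_atTop.const_mul (1 - 2 * m)).const_add (1 / 2)).inv₀ (by norm_num)
    simpa using this
  have hev : ∀ᶠ η : ℝ in atTop, 0 < η ^ 2 / 2 + (1 - 2 * m) := by
    filter_upwards [t2.eventually_gt_atTop (2 * (2 * m - 1))] with η h
    linarith
  have hL := lhop (L := 2 / c ^ 2) ((eventually_gt_atTop 0).mono hF)
    ((eventually_gt_atTop 0).mono hG) ?_ hGt ?_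
  · have := ht.mul hL
    rw [show c * (2 / c ^ 2) = 2 / c by field_simp] at this
    refine this.congr' ?_
    filter_upwards [eventually_gt_atTop 0] with η hη
    have e : η ^ (1 - m) = η ^ (1 - 2 * m) * η ^ m := by
      rw [← rpow_add hη]; congr 1; ring
    have := rpow_pos_of_pos hη (1 - 2 * m)
    rw [e]
    field_simp
  · filter_upwards [hev, eventually_gt_atTop 0] with η h hη
    positivity
  · refine (hr.div (ht.pow 2) (by positivity)).congr' ?_
    filter_upwards [hev, eventually_gt_atTop 0] with η h hη
    have hw := hpos η hη
    have e : (η ^ (1 - m)) ^ 2 = η ^ (-(2 * m)) * η ^ 2 := by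
      rw [← rpow_natCast, ← rpow_mul hη.le, ← rpow_two η, ← rpow_add hη]; congr 1
      push_cast; ring
    have hP := rpow_pos_of_pos hη (-(2 * m))
    have e3 : 1 / 2 + (1 - 2 * m) * (η ^ 2)⁻¹ = (η ^ 2 / 2 + (1 - 2 * m)) / η ^ 2 := by
      field_simp
    simp only [Pi.div_apply, Pi.pow_apply]
    rw [mul_pow, mul_pow, e, Real.exp_neg, e3]
    generalize η ^ 2 / 2 + (1 - 2 * m) = Q at *
    field_simp

theorem ode_asymptotic_basis (p : ℝ) (hp1 : 3 / 2 < p) (hp2 : p < 2) :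
    ∃ ω₁ d₁ dd₁ ω₂ d₂ dd₂ : ℝ → ℝ,
      IsODESol p ω₁ d₁ dd₁ ∧ IsODESol p ω₂ d₂ dd₂ ∧
      (∀ a b : ℝ, (∀ η : ℝ, 0 < η → a * ω₁ η + b * ω₂ η = 0) → a = 0 ∧ b = 0) ∧
      (∃ c₁ : ℝ, 0 < c₁ ∧
        Tendsto (fun η : ℝ => ω₁ η * Real.exp (η ^ 2 / 4) * η ^ (1 - 1 / (p - 1)))
          atTop (𝓝 c₁)) ∧
      (∃ c₂ : ℝ, 0 < c₂ ∧
        Tendsto (fun η : ℝ => ω₂ η * η ^ (1 / (p - 1))) atTop (𝓝 c₂)) ∧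
      (∀ ω d dd : ℝ → ℝ, IsODESol p ω d dd →
        Tendsto (fun η : ℝ => η ^ (1 / (p - 1)) * ω η) atTop (𝓝 0) →
        ∃ c : ℝ, ∀ η : ℝ, 0 < η → ω η = c * ω₁ η) := by
  obtain ⟨ω₁, d₁, dd₁, hsol, hpos, c₁, hc₁, ht₁⟩ := exists_first p hp1 hp2
  have hsol' := hsol
  obtain ⟨h1, h2, -, h4⟩ := hsol'
  have hcont : ContinuousOn (fun s : ℝ => Real.exp (-(s ^ 2 / 4)) / ω₁ s ^ 2) (Ioi 0) := by
    have : ContinuousOn ω₁ (Ioi 0) := fun x hx => (h1 x hx).continuousAt.continuousWithinAt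
    refine ContinuousOn.div (by fun_prop) (by fun_prop) ?_
    intro x hx
    have := hpos x hx
    positivity
  obtain ⟨F, hF⟩ : ∃ F : ℝ → ℝ, ∀ η : ℝ, 0 < η →
      HasDerivAt F (Real.exp (-(η ^ 2 / 4)) / ω₁ η ^ 2) η := by
    refine ⟨fun η => ∫ s in (1:ℝ)..η, Real.exp (-(s ^ 2 / 4)) / ω₁ s ^ 2, fun η hη => ?_⟩
    refine intervalIntegral.integral_hasDerivAt_right ?_ ?_ ?_
    · apply ContinuousOn.intervalIntegrable
      refine hcont.mono fun x hx => ?_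
      exact lt_of_lt_of_le (lt_min one_pos hη) hx.1
    · exact hcont.stronglyMeasurableAtFilter isOpen_Ioi _ hη
    · exact hcont.continuousAt (Ioi_mem_nhds hη)
  have ht₂ := main_aux (1 / (p - 1)) hc₁ hpos ht₁ hF
  have ht0 : Tendsto (fun η : ℝ => ω₁ η * η ^ (1 / (p - 1))) atTop (𝓝 0) := by
    have := ht₁.mul (tend_pow_exp (2 * (1 / (p - 1)) - 1) (b := 1 / 4) (by norm_num))
    rw [mul_zero] at this
    refine this.congr' ?_
    filter_upwards [eventually_gt_atTop 0] with η hη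
    have e : η ^ (1 / (p - 1)) = η ^ (1 - 1 / (p - 1)) * η ^ (2 * (1 / (p - 1)) - 1) := by
      rw [← rpow_add hη]; congr 1; ring
    have e' : Real.exp (η ^ 2 / 4) * rexp (-(1 / 4) * η ^ 2) = 1 := by
      rw [← Real.exp_add, show η ^ 2 / 4 + -(1 / 4) * η ^ 2 = 0 by ring, Real.exp_zero]
    rw [e]
    linear_combination (ω₁ η * η ^ (1 - 1 / (p - 1)) * η ^ (2 * (1 / (p - 1)) - 1)) * e'
  have hcomb : ∀ a b : ℝ, Tendsto (fun η : ℝ => (a * ω₁ η + b * (ω₁ η * F η)) * η ^ (1 / (p - 1)))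
      atTop (𝓝 (b * (2 / c₁))) := by
    intro a b
    have := (ht0.const_mul a).add (ht₂.const_mul b)
    rw [mul_zero, zero_add] at this
    refine this.congr fun η => ?_
    ring
  have hc₂ : 0 < 2 / c₁ := by positivity
  refine ⟨ω₁, d₁, dd₁, fun η => ω₁ η * F η, fun η => d₁ η * F η + Real.exp (-(η ^ 2 / 4)) / ω₁ η,
    fun η => dd₁ η * F η - η / 2 * (Real.exp (-(η ^ 2 / 4)) / ω₁ η), hsol, ?_, ?_,
    ⟨c₁, hc₁, ht₁⟩, ⟨2 / c₁, hc₂, ht₂⟩, ?_⟩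
  · refine isODESol_mk ?_ ?_ ?_
    · intro η hη
      have := (hpos η hη).ne'
      convert! (h1 η hη).mul (hF η hη) using 1
      field_simp
    · intro η hη
      have := (hpos η hη).ne'
      convert! ((h2 η hη).mul (hF η hη)).add ((hasDerivAt_gauss η).div (h1 η hη) this) using 1
      field_simp
      ring
    · intro η hη
      have := h4 η hη
      linear_combination F η * this
  · intro a b hab
    have hb : b * (2 / c₁) = 0 := by
      refine tendsto_nhds_unique (hcomb a b) (tendsto_const_nhds.congr' ?_)
      filter_upwards [eventually_gt_atTop 0] with η hη
      rw [hab η hη, zero_mul]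
    have hb0 : b = 0 := (mul_eq_zero.1 hb).resolve_right hc₂.ne'
    refine ⟨?_, hb0⟩
    have := hab 1 one_pos
    rw [hb0, zero_mul, add_zero] at this
    exact (mul_eq_zero.1 this).resolve_right (hpos 1 one_pos).ne'
  · intro ω d dd hs hlim
    obtain ⟨g1, g2, -, g4⟩ := hs
    have const : ∀ f : ℝ → ℝ, (∀ η : ℝ, 0 < η → HasDerivAt f 0 η) → ∃ K : ℝ, ∀ η : ℝ, 0 < η → f η = K := by
      intro f hf
      refine ⟨f 1, fun η hη => ?_⟩
      exact isOpen_Ioi.is_const_of_deriv_eq_zero (isPreconnected_Ioi (a := (0:ℝ)))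
        (fun x hx => (hf x hx).differentiableAt.differentiableWithinAt)
        (fun x hx => (hf x hx).deriv) hη (mem_Ioi.2 one_pos)
    obtain ⟨K, hK⟩ := const
      (fun η => (ω₁ η * d η - d₁ η * ω η) / Real.exp (-(η ^ 2 / 4))) (by
      intro η hη
      convert! (((h1 η hη).mul (g2 η hη)).sub ((h2 η hη).mul (g1 η hη))).div
        (hasDerivAt_gauss η) (Real.exp_pos _).ne' using 1
      simp only [Pi.sub_apply, Pi.mul_apply]
      symm
      rw [div_eq_zero_iff]
      left
      linear_combination Real.exp (-(η ^ 2 / 4)) * ω₁ η * g4 η hη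
        - Real.exp (-(η ^ 2 / 4)) * ω η * h4 η hη)
    obtain ⟨C, hC⟩ := const (fun η => ω η / ω₁ η - K * F η) (by
      intro η hη
      have hw := (hpos η hη).ne'
      convert! ((g1 η hη).div (h1 η hη) hw).sub ((hF η hη).const_mul K) using 1
      have := hK η hη
      rw [div_eq_iff (Real.exp_pos _).ne'] at this
      field_simp
      linear_combination -this)
    have hform : ∀ η : ℝ, 0 < η → ω η = C * ω₁ η + K * (ω₁ η * F η) := by
      intro η hη
      have hw := (hpos η hη).ne'
      have := hC η hη
      field_simp at this
      linear_combination this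
    have hK0 : K * (2 / c₁) = 0 := by
      refine tendsto_nhds_unique (hcomb C K) (hlim.congr' ?_)
      filter_upwards [eventually_gt_atTop 0] with η hη
      rw [hform η hη]
      ring
    have hK1 : K = 0 := (mul_eq_zero.1 hK0).resolve_right hc₂.ne'
    refine ⟨C, fun η hη => ?_⟩
    rw [hform η hη, hK1]
    ring
end
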